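/- Let G be the complete multipartite graph with vertex partition V_1 ⊔ ⋯ ⊔ V_n where |V_i| = w_i and w_1 ≤ ⋯ ≤ w_n, and let J(G) be its cover ideal in the standard-graded polynomial ring on the vertex set. Then reg(S/J(G)^s) = s·∑_{l=1}^n w_l − (s+1) if s < n−1, and reg(S/J(G)^s) = s·∑_{l=1}^n w_l − w_1(s−n+1) − n if s ≥ n−1. -/

import Mathlib

open MvPolynomial

/-- `f`, an element of the free module over `k[X_v : v : σ]` with basis indexed
by `Σ j, Fin (βi j)` (basis elements over `j` having degree `j`), is homogeneous
of degree `dg` for the standard grading. -/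
def HomogOfDeg (k : Type*) [Field k] (σ : Type*) (βi : ℕ → ℕ) (dg : ℕ)
    (f : ((j : ℕ) × Fin (βi j)) →₀ MvPolynomial σ k) : Prop :=
  ∀ p : (j : ℕ) × Fin (βi j),
    f p ∈ homogeneousSubmodule σ k (dg - p.1) ∧ (dg < p.1 → f p = 0)

/-- `β : ℕ → ℕ → ℕ` is the table of graded Betti numbers of the graded module
`M` over the standard-graded polynomial ring `S = k[X_v : v : σ]` (with `Hdeg d`
the set of homogeneous elements of `M` of degree `d`): there is a minimal graded
free resolution of `M` whose `i`-th term has `β i j` basis elements of degree `j`. -/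
def IsMinimalGradedFreeResolution (k : Type*) [Field k] (σ : Type*)
    (β : ℕ → ℕ → ℕ) (M : Type*) [AddCommGroup M]
    [Module (MvPolynomial σ k) M] (Hdeg : ℕ → Set M) : Prop :=
  ∃ (d : (i : ℕ) → (((j : ℕ) × Fin (β (i + 1) j)) →₀ MvPolynomial σ k)
        →ₗ[MvPolynomial σ k] (((j : ℕ) × Fin (β i j)) →₀ MvPolynomial σ k))
    (ε : (((j : ℕ) × Fin (β 0 j)) →₀ MvPolynomial σ k) →ₗ[MvPolynomial σ k] M),
    Function.Surjective ε ∧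
    LinearMap.ker ε = LinearMap.range (d 0) ∧
    (∀ i, LinearMap.ker (d i) = LinearMap.range (d (i + 1))) ∧
    (∀ i p q, constantCoeff (d i (Finsupp.single p 1) q) = 0) ∧
    (∀ i dg f, HomogOfDeg k σ (β (i + 1)) dg f → HomogOfDeg k σ (β i) dg (d i f)) ∧
    (∀ dg f, HomogOfDeg k σ (β 0) dg f → ε f ∈ Hdeg dg)

namespace GradedFree

variable {k : Type*} [Field k] {σ : Type*} {ι κ : Type*}

/-- Homogeneity of degree `e` in the free module whose basis vectors have degrees `deg`. -/
def IsHomog (deg : ι → ℕ) (e : ℕ) (f : ι →₀ MvPolynomial σ k) : Prop :=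
  ∀ p, (f p).IsHomogeneous (e - deg p) ∧ (e < deg p → f p = 0)

lemma IsHomog.zero (deg : ι → ℕ) (e : ℕ) : IsHomog deg e (0 : ι →₀ MvPolynomial σ k) :=
  fun _ => ⟨isHomogeneous_zero _ _ _, fun _ => rfl⟩

lemma IsHomog.add {deg : ι → ℕ} {e : ℕ} {f g : ι →₀ MvPolynomial σ k}
    (hf : IsHomog deg e f) (hg : IsHomog deg e g) : IsHomog deg e (f + g) :=
  fun p => ⟨(hf p).1.add (hg p).1, fun h => by simp [(hf p).2 h, (hg p).2 h]⟩

lemma IsHomog.sum {α : Type*} {deg : ι → ℕ} {e : ℕ} (s : Finset α)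
    (f : α → ι →₀ MvPolynomial σ k) (hf : ∀ i ∈ s, IsHomog deg e (f i)) :
    IsHomog deg e (∑ i ∈ s, f i) :=
  Finset.sum_induction f _ (fun _ _ => .add) (.zero _ _) hf

lemma IsHomog.smul {deg : ι → ℕ} {e j : ℕ} {f : ι →₀ MvPolynomial σ k}
    {a : MvPolynomial σ k} (ha : a.IsHomogeneous j) (hf : IsHomog deg e f) :
    IsHomog deg (e + j) (a • f) := by
  intro p
  by_cases h : e < deg p
  · simp [(hf p).2 h, isHomogeneous_zero]
  · refine ⟨?_, fun h' => by omega⟩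
    have := ha.mul (hf p).1
    rwa [show j + (e - deg p) = e + j - deg p by omega] at this

lemma isHomog_single (deg : ι → ℕ) (p : ι) {a : MvPolynomial σ k} {j : ℕ}
    (ha : a.IsHomogeneous j) : IsHomog deg (deg p + j) (Finsupp.single p a) := by
  classical
  intro q
  rw [Finsupp.single_apply]
  split_ifs with h
  · subst h
    exact ⟨by simpa using ha, fun h => by omega⟩
  · exact ⟨isHomogeneous_zero _ _ _, fun _ => rfl⟩

lemma isHomog_map {deg : ι → ℕ} {deg' : κ → ℕ}
    {T : (ι →₀ MvPolynomial σ k) →ₗ[MvPolynomial σ k] (κ →₀ MvPolynomial σ k)}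
    (hT : ∀ p, IsHomog deg' (deg p) (T (Finsupp.single p 1)))
    {e : ℕ} {f : ι →₀ MvPolynomial σ k} (hf : IsHomog deg e f) : IsHomog deg' e (T f) := by
  rw [← Finsupp.sum_single f, Finsupp.sum, map_sum]
  refine .sum _ _ fun p hp => ?_
  have h1 : T (Finsupp.single p (f p)) = f p • T (Finsupp.single p 1) := by
    rw [← map_smul, Finsupp.smul_single_one]
  have h2 : ¬ e < deg p := fun h => Finsupp.mem_support_iff.1 hp ((hf p).2 h)
  have h3 := (hT p).smul (hf p).1
  rwa [h1, show e = deg p + (e - deg p) by omega]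

/-- The homogeneous component of degree `e` in a graded free module. -/
noncomputable def comp (deg : ι → ℕ) (e : ℕ) :
    (ι →₀ MvPolynomial σ k) →+ (ι →₀ MvPolynomial σ k) :=
  Finsupp.liftAddHom fun p => (Finsupp.singleAddHom p).comp
    (if deg p ≤ e then (homogeneousComponent (e - deg p)).toAddMonoidHom else 0)

lemma comp_single (deg : ι → ℕ) (e : ℕ) (p : ι) (a : MvPolynomial σ k) :
    comp deg e (Finsupp.single p a) =
      Finsupp.single p (if deg p ≤ e then homogeneousComponent (e - deg p) a else 0) := by
  simp only [comp, Finsupp.liftAddHom_apply_single, AddMonoidHom.comp_apply]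
  split_ifs <;> simp

lemma comp_apply (deg : ι → ℕ) (e : ℕ) (f : ι →₀ MvPolynomial σ k) (q : ι) :
    comp deg e f q = if deg q ≤ e then homogeneousComponent (e - deg q) (f q) else 0 := by
  classical
  induction f using Finsupp.induction_linear with
  | zero => simp
  | add f g hf hg => simp only [map_add, Finsupp.add_apply, hf, hg]; split_ifs <;> simp
  | single p a =>
    rw [comp_single]
    by_cases h : p = q
    · subst h; simp
    · simp [h]

lemma isHomog_comp (deg : ι → ℕ) (e : ℕ) (f : ι →₀ MvPolynomial σ k) :
    IsHomog deg e (comp deg e f) := by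
  intro p
  rw [comp_apply]
  split_ifs with h
  · exact ⟨homogeneousComponent_isHomogeneous _ _, fun h' => by omega⟩
  · exact ⟨isHomogeneous_zero _ _ _, fun _ => rfl⟩

lemma comp_of_isHomog {deg : ι → ℕ} {e e' : ℕ} {f : ι →₀ MvPolynomial σ k}
    (hf : IsHomog deg e f) : comp deg e' f = if e' = e then f else 0 := by
  ext1 p
  rw [comp_apply]
  by_cases h0 : e < deg p
  · simp only [(hf p).2 h0, map_zero, ite_self]
    split_ifs
    · exact ((hf p).2 h0).symm
    · rfl
  · split_ifs with h1 h2 h2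
    · subst h2
      exact homogeneousComponent_eq_self (hf p).1
    · rw [homogeneousComponent_of_mem (hf p).1, if_neg (by omega)]; rfl
    · omega
    · rfl

/-- Additive maps on a graded free module agree if they agree on the elements
`monomial m r • e_p`. -/
lemma induction_monomial {P : (ι →₀ MvPolynomial σ k) → Prop} (f : ι →₀ MvPolynomial σ k)
    (zero : P 0) (add : ∀ f g, P f → P g → P (f + g))
    (single : ∀ p m r, P (Finsupp.single p (monomial m r))) : P f := by
  induction f using Finsupp.induction_linear with
  | zero => exact zero
  | add f g hf hg => exact add f g hf hg
  | single p a =>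
    induction a using MvPolynomial.induction_on' with
    | monomial m r => exact single p m r
    | add a b ha hb => rw [Finsupp.single_add]; exact add _ _ ha hb

lemma comp_map {deg : ι → ℕ} {deg' : κ → ℕ}
    {T : (ι →₀ MvPolynomial σ k) →ₗ[MvPolynomial σ k] (κ →₀ MvPolynomial σ k)}
    (hT : ∀ p, IsHomog deg' (deg p) (T (Finsupp.single p 1))) (e : ℕ)
    (f : ι →₀ MvPolynomial σ k) : T (comp deg e f) = comp deg' e (T f) := by
  induction f using induction_monomial with
  | zero => simp
  | add f g hf hg => simp [hf, hg]
  | single p m r =>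
    have h := isHomog_single deg p (isHomogeneous_monomial (σ := σ) r (rfl : m.degree = m.degree))
    rw [comp_of_isHomog h, comp_of_isHomog (isHomog_map hT h)]
    split_ifs <;> simp

/-- The homogeneous elements of degree `e` of a quotient of the polynomial ring. -/
def quotHomog (I : Ideal (MvPolynomial σ k)) (e : ℕ) : Set (MvPolynomial σ k ⧸ I) :=
  {x | ∃ f ∈ homogeneousSubmodule σ k e, Ideal.Quotient.mk I f = x}

lemma exists_lift_comp {I : Ideal (MvPolynomial σ k)} {deg : ι → ℕ}
    {T : (ι →₀ MvPolynomial σ k) →ₗ[MvPolynomial σ k] (MvPolynomial σ k ⧸ I)}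
    (hT : ∀ p, T (Finsupp.single p 1) ∈ quotHomog I (deg p)) (f : ι →₀ MvPolynomial σ k) :
    ∃ a, Ideal.Quotient.mk I a = T f ∧
      ∀ e, Ideal.Quotient.mk I (homogeneousComponent e a) = T (comp deg e f) := by
  induction f using induction_monomial with
  | zero => exact ⟨0, by simp, by simp⟩
  | add f g hf hg =>
    obtain ⟨a, ha, ha'⟩ := hf
    obtain ⟨b, hb, hb'⟩ := hg
    exact ⟨a + b, by simp [ha, hb], fun e => by simp [ha', hb']⟩
  | single p m r =>
    obtain ⟨a, ha, ha'⟩ := hT p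
    have h1 := isHomogeneous_monomial (σ := σ) r (rfl : m.degree = m.degree)
    have h2 : Ideal.Quotient.mk I (monomial m r * a) = T (Finsupp.single p (monomial m r)) := by
      rw [← Finsupp.smul_single_one, map_smul, ← ha', map_mul]
      rfl
    refine ⟨monomial m r * a, h2, fun e => ?_⟩
    have h3 : (monomial m r * a).IsHomogeneous (deg p + m.degree) := by
      rw [add_comm]; exact h1.mul ha
    rw [comp_of_isHomog (isHomog_single deg p h1), homogeneousComponent_of_mem h3]
    split_ifs <;> simp [h2]

/-- A graded free resolution of `S ⧸ I` with explicit basis degrees. -/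
structure Res (I : Ideal (MvPolynomial σ k)) (ι : ℕ → Type*) (deg : ∀ i, ι i → ℕ) where
  /-- the differentials -/
  d : ∀ i, (ι (i + 1) →₀ MvPolynomial σ k) →ₗ[MvPolynomial σ k] (ι i →₀ MvPolynomial σ k)
  /-- the augmentation -/
  ε : (ι 0 →₀ MvPolynomial σ k) →ₗ[MvPolynomial σ k] (MvPolynomial σ k ⧸ I)
  surj : Function.Surjective ε
  exact_zero : LinearMap.ker ε = LinearMap.range (d 0)
  exact_succ : ∀ i, LinearMap.ker (d i) = LinearMap.range (d (i + 1))
  d_homog : ∀ i p, IsHomog (deg i) (deg (i + 1) p) (d i (Finsupp.single p 1))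
  ε_homog : ∀ p, ε (Finsupp.single p 1) ∈ quotHomog I (deg 0 p)

/-- A sequence of choices, each constrained by the previous one. -/
lemma exists_dependent_seq {α : ℕ → Type*} (P : ∀ i, α i → Prop)
    (r : ∀ i, α i → α (i + 1) → Prop) (a₀ : α 0) (h₀ : P 0 a₀)
    (step : ∀ i a, P i a → ∃ a', P (i + 1) a' ∧ r i a a') :
    ∃ f : ∀ i, α i, f 0 = a₀ ∧ ∀ i, P i (f i) ∧ r i (f i) (f (i + 1)) := by
  choose g hg hr using step
  let F : ∀ i, {a : α i // P i a} := fun i =>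
    Nat.rec ⟨a₀, h₀⟩ (fun i a => ⟨g i a.1 a.2, hg i a.1 a.2⟩) i
  exact ⟨fun i => (F i).1, rfl, fun i => ⟨(F i).2, hr i (F i).1 (F i).2⟩⟩

lemma exists_linearMap_lift {R A B : Type*} [CommRing R] [AddCommGroup A] [Module R A]
    [AddCommGroup B] [Module R B] (h : (ι →₀ R) →ₗ[R] B) (d : A →ₗ[R] B)
    (Q : ι → A → Prop) (hQ : ∀ p, ∃ x, Q p x ∧ d x = h (Finsupp.single p 1)) :
    ∃ φ : (ι →₀ R) →ₗ[R] A, d ∘ₗ φ = h ∧ ∀ p, Q p (φ (Finsupp.single p 1)) := by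
  choose x hx hx' using hQ
  refine ⟨Finsupp.linearCombination R x, ?_, fun p => by simpa using hx p⟩
  ext p
  simp [hx']

namespace Res

variable {I : Ideal (MvPolynomial σ k)} {ι κ : ℕ → Type*} {deg : ∀ i, ι i → ℕ}
  {deg' : ∀ i, κ i → ℕ}

lemma d_comp_d (F : Res I ι deg) (i : ℕ) : F.d i ∘ₗ F.d (i + 1) = 0 :=
  LinearMap.range_le_ker_iff.1 (F.exact_succ i).ge

lemma ε_comp_d (F : Res I ι deg) : F.ε ∘ₗ F.d 0 = 0 :=
  LinearMap.range_le_ker_iff.1 F.exact_zero.ge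

section
attribute [local instance] MvPolynomial.gradedAlgebra

lemma exists_homog_ε (hI : I.IsHomogeneous (homogeneousSubmodule σ k)) (F : Res I ι deg) {e : ℕ}
    {y : MvPolynomial σ k ⧸ I} (hy : y ∈ quotHomog I e) :
    ∃ x, IsHomog (deg 0) e x ∧ F.ε x = y := by
  obtain ⟨x, rfl⟩ := F.surj y
  obtain ⟨f, hf, hfx⟩ := hy
  obtain ⟨a, ha, ha'⟩ := exists_lift_comp F.ε_homog x
  refine ⟨comp (deg 0) e x, isHomog_comp _ _ _, ?_⟩
  rw [← ha', ← hfx]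
  rw [← hfx, Ideal.Quotient.mk_eq_mk_iff_sub_mem] at ha
  have := homogeneousComponent_mem_of_mem hI ha e
  rw [map_sub, homogeneousComponent_eq_self hf] at this
  exact (Ideal.Quotient.mk_eq_mk_iff_sub_mem _ _).2 this

end

lemma exists_homog_d (F : Res I ι deg) {i e : ℕ} {y : ι i →₀ MvPolynomial σ k}
    (hy : IsHomog (deg i) e y) (hy' : y ∈ LinearMap.range (F.d i)) :
    ∃ x, IsHomog (deg (i + 1)) e x ∧ F.d i x = y := by
  obtain ⟨x, rfl⟩ := hy'
  refine ⟨comp (deg (i + 1)) e x, isHomog_comp _ _ _, ?_⟩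
  rw [comp_map (F.d_homog i), comp_of_isHomog hy, if_pos rfl]

section
attribute [local instance] MvPolynomial.gradedAlgebra

/-- Any two graded resolutions are related by a homogeneous chain map over the identity. -/
lemma exists_chainMap (hI : I.IsHomogeneous (homogeneousSubmodule σ k))
    (F : Res I ι deg) (G : Res I κ deg') :
    ∃ φ : ∀ i, (ι i →₀ MvPolynomial σ k) →ₗ[MvPolynomial σ k] (κ i →₀ MvPolynomial σ k),
      G.ε ∘ₗ φ 0 = F.ε ∧ (∀ i, G.d i ∘ₗ φ (i + 1) = φ i ∘ₗ F.d i) ∧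
      ∀ i p, IsHomog (deg' i) (deg i p) (φ i (Finsupp.single p 1)) := by
  obtain ⟨φ₀, h₀, h₀'⟩ := exists_linearMap_lift F.ε G.ε (fun p x => IsHomog (deg' 0) (deg 0 p) x)
    fun p => G.exists_homog_ε hI (F.ε_homog p)
  obtain ⟨φ, hφ0, hφ⟩ := exists_dependent_seq
    (α := fun i => (ι i →₀ MvPolynomial σ k) →ₗ[MvPolynomial σ k] (κ i →₀ MvPolynomial σ k))
    (fun i φ => (∀ p, IsHomog (deg' i) (deg i p) (φ (Finsupp.single p 1))) ∧
      ∀ x, φ (F.d i x) ∈ LinearMap.range (G.d i))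
    (fun i φ φ' => G.d i ∘ₗ φ' = φ ∘ₗ F.d i) φ₀
    ⟨h₀', fun x => by
      rw [← G.exact_zero, LinearMap.mem_ker, ← LinearMap.comp_apply, h₀, ← LinearMap.comp_apply,
        ε_comp_d]
      rfl⟩
    (by
      rintro i φ ⟨h1, h2⟩
      obtain ⟨φ', h, h'⟩ := exists_linearMap_lift (φ ∘ₗ F.d i) (G.d i)
        (fun p x => IsHomog (deg' (i + 1)) (deg (i + 1) p) x)
        fun p => G.exists_homog_d (isHomog_map h1 (F.d_homog i p)) (h2 _)
      refine ⟨φ', ⟨h', fun x => ?_⟩, h⟩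
      rw [← G.exact_succ, LinearMap.mem_ker, ← LinearMap.comp_apply, h, LinearMap.comp_apply,
        ← LinearMap.comp_apply (F.d i), d_comp_d]
      simp)
  exact ⟨φ, by rw [hφ0, h₀], fun i => (hφ i).2, fun i => (hφ i).1.1⟩

end

/-- A chain map over zero is null-homotopic. -/
lemma exists_homotopy (F : Res I ι deg) (G : Res I κ deg')
    (h : ∀ i, (ι i →₀ MvPolynomial σ k) →ₗ[MvPolynomial σ k] (κ i →₀ MvPolynomial σ k))
    (h0 : G.ε ∘ₗ h 0 = 0) (hd : ∀ i, G.d i ∘ₗ h (i + 1) = h i ∘ₗ F.d i) :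
    ∃ s : ∀ i, (ι i →₀ MvPolynomial σ k) →ₗ[MvPolynomial σ k] (κ (i + 1) →₀ MvPolynomial σ k),
      h 0 = G.d 0 ∘ₗ s 0 ∧ ∀ i, h (i + 1) = G.d (i + 1) ∘ₗ s (i + 1) + s i ∘ₗ F.d i := by
  obtain ⟨s₀, hs₀, -⟩ := exists_linearMap_lift (h 0) (G.d 0) (fun _ _ => True) fun p => by
    have : h 0 (Finsupp.single p 1) ∈ LinearMap.range (G.d 0) := by
      rw [← G.exact_zero, LinearMap.mem_ker, ← LinearMap.comp_apply, h0]; rfl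
    simpa using this
  obtain ⟨s, hs0, hs⟩ := exists_dependent_seq
    (α := fun i => (ι i →₀ MvPolynomial σ k) →ₗ[MvPolynomial σ k] (κ (i + 1) →₀ MvPolynomial σ k))
    (fun i s => (h i - G.d i ∘ₗ s) ∘ₗ F.d i = 0)
    (fun i s s' => h (i + 1) = G.d (i + 1) ∘ₗ s' + s ∘ₗ F.d i) s₀
    (by ext; simp [← hs₀])
    (by
      intro i s hs
      obtain ⟨s', hs', -⟩ := exists_linearMap_lift (h (i + 1) - s ∘ₗ F.d i) (G.d (i + 1))
        (fun _ _ => True) fun p => by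
          have : (h (i + 1) - s ∘ₗ F.d i) (Finsupp.single p 1) ∈
              LinearMap.range (G.d (i + 1)) := by
            rw [← G.exact_succ, LinearMap.mem_ker, ← LinearMap.comp_apply, LinearMap.comp_sub, hd,
              ← LinearMap.comp_assoc, ← LinearMap.sub_comp, hs]
            rfl
          simpa using this
      refine ⟨s', ?_, by rw [hs']; abel⟩
      have h1 : h (i + 1) - (h (i + 1) - s ∘ₗ F.d i) = s ∘ₗ F.d i := by abel
      rw [hs', h1, LinearMap.comp_assoc, d_comp_d, LinearMap.comp_zero])
  exact ⟨s, by rw [hs0, hs₀], fun i => (hs i).2⟩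

end Res

lemma constantCoeff_map_apply (T : (ι →₀ MvPolynomial σ k) →ₗ[MvPolynomial σ k]
    (κ →₀ MvPolynomial σ k)) (x : ι →₀ MvPolynomial σ k) (p : κ) :
    constantCoeff (T x p) = x.sum fun q a => constantCoeff a *
      constantCoeff (T (Finsupp.single q 1) p) := by
  conv_lhs => rw [← Finsupp.sum_single x]
  simp only [Finsupp.sum, map_sum, Finsupp.finsetSum_apply]
  refine Finset.sum_congr rfl fun q _ => ?_
  rw [← Finsupp.smul_single_one, map_smul, Finsupp.smul_apply, smul_eq_mul, map_mul]

lemma constantCoeff_of_isHomog {deg : ι → ℕ} {e : ℕ} {f : ι →₀ MvPolynomial σ k}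
    (hf : IsHomog deg e f) {p : ι} (hp : constantCoeff (f p) ≠ 0) : deg p = e := by
  by_contra hne
  rcases lt_or_ge e (deg p) with h | h
  · simp [(hf p).2 h] at hp
  · exact hp ((hf p).1.coeff_eq_zero (d := 0) (by simp; omega))

section
attribute [local instance] MvPolynomial.gradedAlgebra

/-- A basis vector of a graded free resolution that does not take part in any cancellation
contributes its degree to every graded free resolution of the same module. -/
theorem Res.exists_deg_eq {I : Ideal (MvPolynomial σ k)}
    (hI : I.IsHomogeneous (homogeneousSubmodule σ k)) {ι κ : ℕ → Type*} {deg : ∀ i, ι i → ℕ}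
    {deg' : ∀ i, κ i → ℕ} (F : Res I ι deg) (G : Res I κ deg') (i : ℕ) (p : ι i)
    (hp : ∀ q, constantCoeff (F.d i (Finsupp.single q 1) p) = 0)
    (hp' : ∀ i' (h : i' + 1 = i) q, constantCoeff (F.d i' (Finsupp.single (h ▸ p) 1) q) = 0) :
    ∃ q, deg' i q = deg i p := by
  obtain ⟨φ, hφ0, hφ, hφd⟩ := F.exists_chainMap hI G
  obtain ⟨ψ, hψ0, hψ, -⟩ := G.exists_chainMap hI F
  obtain ⟨s, hs0, hs⟩ := F.exists_homotopy F (fun i => ψ i ∘ₗ φ i - LinearMap.id)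
    (by rw [LinearMap.comp_sub, ← LinearMap.comp_assoc, hψ0, hφ0]; simp)
    (fun i => by
      rw [LinearMap.comp_sub, ← LinearMap.comp_assoc, hψ, LinearMap.comp_assoc, hφ]
      simp [LinearMap.sub_comp, LinearMap.comp_assoc])
  have key : constantCoeff ((ψ i ∘ₗ φ i - LinearMap.id :
      (ι i →₀ MvPolynomial σ k) →ₗ[MvPolynomial σ k] (ι i →₀ MvPolynomial σ k))
      (Finsupp.single p 1) p) = 0 := by
    have hds : constantCoeff (F.d i (s i (Finsupp.single p 1)) p) = 0 := by
      rw [constantCoeff_map_apply]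
      simp [hp]
    cases i with
    | zero => rw [hs0]; exact hds
    | succ i =>
      rw [hs, LinearMap.add_apply, Finsupp.add_apply, map_add, LinearMap.comp_apply, hds, zero_add,
        LinearMap.comp_apply, constantCoeff_map_apply]
      refine Finset.sum_eq_zero fun q _ => ?_
      dsimp only
      rw [hp' i rfl q, zero_mul]
  simp only [LinearMap.sub_apply, LinearMap.comp_apply, LinearMap.id_apply, Finsupp.sub_apply,
    Finsupp.single_eq_same, map_sub, map_one, sub_eq_zero] at key
  rw [constantCoeff_map_apply] at key
  obtain ⟨q, -, hq⟩ := Finset.exists_ne_zero_of_sum_ne_zero (key.trans_ne one_ne_zero)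
  exact ⟨q, constantCoeff_of_isHomog (hφd i p) (left_ne_zero_of_mul hq)⟩

end

end GradedFree

namespace Koszul

variable {B ν : Type*} [CommRing B] [LinearOrder ν]

/-- The Koszul sign of inserting `m` into `T`. -/
def sgn (B : Type*) [CommRing B] (m : ν) (T : Finset ν) : B := (-1) ^ (T.filter (· < m)).card

lemma sgn_insert {m l : ν} {T : Finset ν} (hl : l ∉ T) :
    sgn B m (insert l T) = if l < m then -sgn B m T else sgn B m T := by
  unfold sgn
  rw [Finset.filter_insert]
  split_ifs with h
  · rw [Finset.card_insert_of_notMem (by simp [hl]), pow_succ, mul_neg_one]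
  · rfl

lemma sgn_insert_self (m : ν) (T : Finset ν) : sgn B m (insert m T) = sgn B m T := by
  simp [sgn, Finset.filter_insert]

lemma sgn_mul_self (m : ν) (T : Finset ν) : sgn B m T * sgn B m T = 1 := by
  rw [sgn, ← mul_pow]; simp

/-- Contraction with the `m`-th dual basis vector of the exterior algebra, whose elements are
described by their coefficients. -/
def contr (m : ν) : (Finset ν → B) →ₗ[B] (Finset ν → B) where
  toFun κ T := if m ∈ T then 0 else sgn B m T * κ (insert m T)
  map_add' x y := by ext T; simp only [Pi.add_apply]; split_ifs <;> ring
  map_smul' c x := by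
    ext T; simp only [Pi.smul_apply, smul_eq_mul, RingHom.id_apply]; split_ifs <;> ring

/-- Exterior multiplication by the `m`-th basis vector. -/
def wedge (m : ν) : (Finset ν → B) →ₗ[B] (Finset ν → B) where
  toFun κ T := if m ∈ T then sgn B m T * κ (T.erase m) else 0
  map_add' x y := by ext T; simp only [Pi.add_apply]; split_ifs <;> ring
  map_smul' c x := by
    ext T; simp only [Pi.smul_apply, smul_eq_mul, RingHom.id_apply]; split_ifs <;> ring

lemma contr_apply (m : ν) (κ : Finset ν → B) (T : Finset ν) :
    contr m κ T = if m ∈ T then 0 else sgn B m T * κ (insert m T) := rfl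

lemma wedge_apply (m : ν) (κ : Finset ν → B) (T : Finset ν) :
    wedge m κ T = if m ∈ T then sgn B m T * κ (T.erase m) else 0 := rfl

lemma contr_contr_self (m : ν) (κ : Finset ν → B) : contr m (contr m κ) = 0 := by
  ext T; simp [contr_apply]

lemma contr_contr (m l : ν) (κ : Finset ν → B) :
    contr m (contr l κ) = -contr l (contr m κ) := by
  rcases eq_or_ne m l with rfl | hne
  · simp [contr_contr_self]
  ext T
  by_cases hm : m ∈ T
  · simp [contr_apply, hm]
  by_cases hl : l ∈ T
  · simp [contr_apply, hl]
  have h1 : m ∉ insert l T := by simp [hm, hne]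
  have h2 : l ∉ insert m T := by simp [hl, hne.symm]
  simp only [contr_apply, Pi.neg_apply, if_neg hm, if_neg hl, if_neg h1, if_neg h2,
    sgn_insert hm, sgn_insert hl, Finset.insert_comm l m]
  rcases lt_or_gt_of_ne hne with h | h
  · simp only [if_pos h, if_neg h.le.not_gt]; ring
  · simp only [if_pos h, if_neg h.le.not_gt]; ring

lemma contr_wedge_self (m : ν) (κ : Finset ν → B) :
    contr m (wedge m κ) + wedge m (contr m κ) = κ := by
  ext T
  by_cases hm : m ∈ T
  · have h : sgn B m (T.erase m) = sgn B m T := by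
      conv_rhs => rw [← Finset.insert_erase hm, sgn_insert_self]
    simp [contr_apply, wedge_apply, hm, h, ← mul_assoc, sgn_mul_self]
  · simp [contr_apply, wedge_apply, hm, sgn_insert_self, ← mul_assoc, sgn_mul_self]

lemma contr_wedge {m l : ν} (hne : m ≠ l) (κ : Finset ν → B) :
    contr m (wedge l κ) = -wedge l (contr m κ) := by
  ext T
  by_cases hm : m ∈ T
  · simp [contr_apply, wedge_apply, hm, hne]
  by_cases hl : l ∈ T
  · obtain ⟨U, hU, rfl⟩ : ∃ U, l ∉ U ∧ insert l U = T :=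
      ⟨T.erase l, by simp, Finset.insert_erase hl⟩
    have hmU : m ∉ U := fun h => hm (by simp [h])
    have h1 : (insert m (insert l U)).erase l = insert m U := by
      rw [Finset.insert_comm, Finset.erase_insert (by simp [hU, hne.symm])]
    simp only [contr_apply, wedge_apply, Pi.neg_apply, Finset.mem_insert,
      or_true, if_true, h1, Finset.erase_insert hU, hmU, hne, or_self, if_false, sgn_insert hU,
      sgn_insert (show m ∉ insert l U from hm), true_or, lt_self_iff_false]
    rcases lt_or_gt_of_ne hne with h | h
    · simp only [if_pos h, if_neg h.le.not_gt]; ring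
    · simp only [if_pos h, if_neg h.le.not_gt]; ring
  · simp [contr_apply, wedge_apply, hm, hl, hne.symm]

/-- The Koszul differential on the elements `g m`, `m ∈ A`. -/
def diff (g : ν → B) (A : Finset ν) : (Finset ν → B) →ₗ[B] (Finset ν → B) :=
  ∑ m ∈ A, g m • contr m

lemma diff_apply (g : ν → B) (A : Finset ν) (κ : Finset ν → B) :
    diff g A κ = ∑ m ∈ A, g m • contr m κ := by
  simp [diff, LinearMap.sum_apply]

lemma diff_insert (g : ν → B) {A : Finset ν} {r : ν} (hr : r ∉ A) (κ : Finset ν → B) :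
    diff g (insert r A) κ = diff g A κ + g r • contr r κ := by
  rw [diff_apply, diff_apply, Finset.sum_insert hr, add_comm]

lemma contr_diff (g : ν → B) (A : Finset ν) (l : ν) (κ : Finset ν → B) :
    contr l (diff g A κ) = -diff g A (contr l κ) := by
  simp only [diff_apply, map_sum, map_smul, ← Finset.sum_neg_distrib]
  exact Finset.sum_congr rfl fun m _ => by rw [contr_contr, smul_neg]

lemma diff_wedge (g : ν → B) {A : Finset ν} {r : ν} (hr : r ∉ A) (κ : Finset ν → B) :
    diff g A (wedge r κ) = -wedge r (diff g A κ) := by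
  simp only [diff_apply, map_sum, map_smul, ← Finset.sum_neg_distrib]
  exact Finset.sum_congr rfl fun m hm => by
    rw [contr_wedge (ne_of_mem_of_not_mem hm hr), smul_neg]

lemma diff_diff (g : ν → B) (A : Finset ν) (κ : Finset ν → B) : diff g A (diff g A κ) = 0 := by
  induction A using Finset.induction_on generalizing κ with
  | empty => simp [diff]
  | insert r A hr ih =>
    simp only [diff_insert g hr, map_add, map_smul, ih, contr_diff, contr_contr_self]
    simp

lemma wedge_empty (m : ν) (κ : Finset ν → B) : wedge m κ ∅ = 0 := by simp [wedge_apply]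

lemma diff_empty_apply (g : ν → B) (A : Finset ν) (κ : Finset ν → B) :
    diff g A κ ∅ = ∑ m ∈ A, g m * κ {m} := by
  simp [diff_apply, Finset.sum_apply, contr_apply, sgn]

lemma eq_zero_of_contr {κ : Finset ν → B} (h0 : κ ∅ = 0) (h : ∀ l, contr l κ = 0) : κ = 0 := by
  ext T
  rcases T.eq_empty_or_nonempty with rfl | ⟨l, hl⟩
  · exact h0
  · have := congrFun (h l) (T.erase l)
    simp only [contr_apply, Finset.notMem_erase, if_false, Finset.insert_erase hl,
      Pi.zero_apply] at this
    have h2 := congrArg (sgn B l (T.erase l) * ·) this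
    simpa [← mul_assoc, sgn_mul_self] using h2

lemma exists_diff_empty_eq (g : ν → B) (A : Finset ν) {b : B} (hb : b ∈ Ideal.span (g '' A)) :
    ∃ μ : Finset ν → B, μ ∅ = 0 ∧ (∀ l ∉ A, contr l μ = 0) ∧ diff g A μ ∅ = b := by
  induction hb using Submodule.span_induction with
  | mem x hx =>
    obtain ⟨m, hm, rfl⟩ := hx
    refine ⟨wedge m (Pi.single ∅ 1), wedge_empty _ _, fun l hl => ?_, ?_⟩
    · have : contr l (Pi.single ∅ 1 : Finset ν → B) = 0 := by ext T; simp [contr_apply]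
      rw [contr_wedge (ne_of_mem_of_not_mem hm hl).symm, this, map_zero, neg_zero]
    · rw [diff_empty_apply, Finset.sum_eq_single m]
      · simp [wedge_apply, sgn, Finset.filter_singleton]
      · intro l _ hl
        simp [wedge_apply, hl.symm]
      · exact fun h => absurd hm h
  | zero => exact ⟨0, by simp, by simp, by simp⟩
  | add x y _ _ hx hy =>
    obtain ⟨μ, h1, h2, rfl⟩ := hx
    obtain ⟨μ', h1', h2', rfl⟩ := hy
    exact ⟨μ + μ', by simp [h1, h1'], fun l hl => by rw [map_add, h2 l hl, h2' l hl, add_zero],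
      by simp⟩
  | smul c x _ hx =>
    obtain ⟨μ, h1, h2, rfl⟩ := hx
    exact ⟨c • μ, by simp [h1], fun l hl => by rw [map_smul, h2 l hl, smul_zero], by simp⟩

/-- The Koszul complex of a permutable regular sequence is exact in positive degrees. -/
theorem exists_diff_eq {g : ν → B}
    (hg : ∀ (A : Finset ν) (l : ν), l ∉ A → ∀ b, g l * b ∈ Ideal.span (g '' A) →
      b ∈ Ideal.span (g '' A)) (A : Finset ν) (κ : Finset ν → B) (h0 : κ ∅ = 0)
    (hA : ∀ l ∉ A, contr l κ = 0) (hd : diff g A κ = 0) :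
    ∃ μ : Finset ν → B, μ ∅ = 0 ∧ (∀ l ∉ A, contr l μ = 0) ∧ diff g A μ = κ := by
  induction A using Finset.induction_on generalizing κ with
  | empty => exact ⟨0, rfl, by simp, by simp [eq_zero_of_contr h0 fun l => hA l (by simp)]⟩
  | insert r A hr ih =>
    have hout : ∀ l ∉ A, contr l (contr r κ) = 0 := by
      intro l hl
      rcases eq_or_ne l r with rfl | hlr
      · exact contr_contr_self _ _
      · rw [contr_contr, hA l (by simp [hl, hlr]), map_zero, neg_zero]
    have hd1 : diff g A (contr r κ) = 0 := by
      have := congrArg (contr r) hd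
      rw [diff_insert g hr, map_add, map_smul, contr_contr_self, smul_zero, add_zero, map_zero,
        contr_diff, neg_eq_zero] at this
      exact this
    have hmem : contr r κ ∅ ∈ Ideal.span (g '' A) := by
      apply hg A r hr
      have := congrFun hd ∅
      rw [diff_insert g hr, Pi.add_apply, diff_empty_apply, Pi.smul_apply, smul_eq_mul,
        Pi.zero_apply, add_comm, add_eq_zero_iff_eq_neg] at this
      rw [this]
      exact neg_mem (sum_mem fun m hm =>
        Ideal.mul_mem_right _ _ (Ideal.subset_span ⟨m, hm, rfl⟩))
    obtain ⟨μ, hμ0, hμ, hμd⟩ := exists_diff_empty_eq g A hmem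
    obtain ⟨θ, hθ0, hθ, hθd⟩ := ih (contr r κ - diff g A μ) (by simp [hμd])
      (fun l hl => by rw [map_sub, hout l hl, contr_diff, hμ l hl]; simp)
      (by rw [map_sub, hd1, diff_diff, sub_zero])
    obtain ⟨η, hη0, hη, hηd⟩ : ∃ η : Finset ν → B, η ∅ = 0 ∧ (∀ l ∉ A, contr l η = 0) ∧
        diff g A η = contr r κ :=
      ⟨μ + θ, by simp [hμ0, hθ0], fun l hl => by rw [map_add, hμ l hl, hθ l hl, add_zero],
        by rw [map_add, hθd]; abel⟩
    have hcw : contr r (wedge r η) = η := by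
      have := contr_wedge_self r η
      rwa [hη r hr, map_zero, add_zero] at this
    have hrd : contr r (κ + diff g (insert r A) (wedge r η)) = 0 := by
      rw [map_add, contr_diff, hcw, diff_insert g hr, hη r hr, hηd]; simp
    obtain ⟨ξ, hξ0, hξ, hξd⟩ := ih (κ + diff g (insert r A) (wedge r η))
      (by
        rw [diff_insert g hr, hcw, diff_wedge g hr]
        simp [h0, hη0, wedge_empty])
      (by
        intro l hl
        rcases eq_or_ne l r with rfl | hlr
        · exact hrd
        · rw [map_add, hA l (by simp [hl, hlr]), contr_diff, contr_wedge hlr, hη l hl]; simp)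
      (by
        have := diff_insert g hr (κ + diff g (insert r A) (wedge r η))
        rw [hrd, smul_zero, add_zero] at this
        rw [← this, map_add, hd, diff_diff, add_zero])
    refine ⟨ξ - wedge r η, by simp [hξ0, wedge_empty], fun l hl => ?_, ?_⟩
    · simp only [Finset.mem_insert, not_or] at hl
      rw [map_sub, hξ l hl.2, contr_wedge hl.1, hη l hl.2]; simp
    · rw [map_sub, diff_insert g hr ξ, hξ r hr, hξd]; simp

end Koszul

/-- The kernel of a linear map sending basis vectors to basis vectors is spanned by the differences
of basis vectors with the same image. -/
lemma ker_le_of_basis {R M M' ι ι' : Type*} [CommRing R] [AddCommGroup M] [Module R M]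
    [AddCommGroup M'] [Module R M'] (b : Module.Basis ι R M) (b' : Module.Basis ι' R M')
    (Φ : M →ₗ[R] M') (φ : ι → ι') (hΦ : ∀ i, Φ (b i) = b' (φ i)) (N : Submodule R M)
    (hN : ∀ i j, φ i = φ j → b i - b j ∈ N) : LinearMap.ker Φ ≤ N := by
  classical
  let L : M' →ₗ[R] M ⧸ N :=
    b'.constr R fun y => if h : ∃ i, φ i = y then N.mkQ (b h.choose) else 0
  have hL : L ∘ₗ Φ = N.mkQ := by
    refine b.ext fun i => ?_
    have h : ∃ j, φ j = φ i := ⟨i, rfl⟩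
    rw [LinearMap.comp_apply, hΦ, Module.Basis.constr_basis, dif_pos h]
    exact (Submodule.Quotient.eq N).2 (hN _ _ h.choose_spec)
  intro x hx
  rw [← N.ker_mkQ, ← hL, LinearMap.mem_ker, LinearMap.comp_apply, LinearMap.mem_ker.1 hx, map_zero]

namespace Multipartite

variable {k : Type*} [Field k] {σ : Type*} {N : ℕ}

/-- Monomials in the variables `X_v` and `T_l`. -/
noncomputable def mon (k : Type*) [Field k] (a : σ →₀ ℕ) (c : Fin (N + 1) →₀ ℕ) :
    MvPolynomial (Fin (N + 1)) (MvPolynomial σ k) := monomial c (monomial a 1)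

lemma mon_mul (a a' : σ →₀ ℕ) (c c' : Fin (N + 1) →₀ ℕ) :
    mon k a c * mon k a' c' = mon k (a + a') (c + c') := by simp [mon, monomial_mul]

lemma mon_pow (a : σ →₀ ℕ) (c : Fin (N + 1) →₀ ℕ) (e : ℕ) :
    mon k a c ^ e = mon k (e • a) (e • c) := by simp [mon, monomial_pow]

lemma mon_prod {τ : Type*} (s : Finset τ) (a : τ → σ →₀ ℕ) (c : τ → Fin (N + 1) →₀ ℕ) :
    ∏ i ∈ s, mon k (a i) (c i) = mon k (∑ i ∈ s, a i) (∑ i ∈ s, c i) := by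
  classical
  induction s using Finset.induction_on with
  | empty => simp [mon]
  | insert i s hi ih => rw [Finset.prod_insert hi, ih, mon_mul, Finset.sum_insert hi,
      Finset.sum_insert hi]

variable [Fintype σ]

/-- The exponent vector of the product of the variables satisfying `p`. -/
noncomputable def ind (p : σ → Prop) [DecidablePred p] : σ →₀ ℕ :=
  Finsupp.equivFunOnFinite.symm fun v => if p v then 1 else 0

lemma ind_apply (p : σ → Prop) [DecidablePred p] (v : σ) : ind p v = if p v then 1 else 0 := rfl

lemma degree_ind (p : σ → Prop) [DecidablePred p] :
    (ind p).degree = (Finset.univ.filter p).card := by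
  rw [Finsupp.degree_eq_sum, Finset.card_filter]; rfl

lemma prod_X_eq (p : σ → Prop) [DecidablePred p] :
    ∏ v ∈ Finset.univ.filter p, (X v : MvPolynomial σ k) = monomial (ind p) 1 := by
  rw [monomial_eq, Finsupp.prod_fintype _ _ (by simp), C_1, one_mul, Finset.prod_filter]
  exact Finset.prod_congr rfl fun v _ => by rw [ind_apply]; split_ifs <;> simp

variable (π : σ → Fin (N + 1))

/-- The monomial `T_l ∏ X_v`, the product being over the `l`-th part. -/
noncomputable def blk (k : Type*) [Field k] (l : Fin (N + 1)) :
    MvPolynomial (Fin (N + 1)) (MvPolynomial σ k) :=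
  mon k (ind fun v => π v = l) (Finsupp.single l 1)

/-- The defining relations of the Rees algebra of the cover ideal. -/
noncomputable def rel (k : Type*) [Field k] (m : Fin N) :
    MvPolynomial (Fin (N + 1)) (MvPolynomial σ k) := blk π k 0 - blk π k m.succ

/-- The indices occurring in the relations indexed by `A`. -/
def hull (A : Finset (Fin N)) : Finset (Fin (N + 1)) := insert 0 (A.map (Fin.succEmb N))

lemma zero_mem_hull (A : Finset (Fin N)) : 0 ∈ hull A := Finset.mem_insert_self _ _

lemma succ_mem_hull {A : Finset (Fin N)} {m : Fin N} : m.succ ∈ hull A ↔ m ∈ A := by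
  simp [hull]

lemma hull_univ : hull (Finset.univ : Finset (Fin N)) = Finset.univ := by
  ext l
  refine Fin.cases ?_ (fun m => ?_) l
  · simp [zero_mem_hull]
  · simp [succ_mem_hull]

lemma blk_sub_blk_mem {A : Finset (Fin N)} {l m : Fin (N + 1)} (hl : l ∈ hull A)
    (hm : m ∈ hull A) : blk π k l - blk π k m ∈ Ideal.span (rel π k '' A) := by
  have key : ∀ l ∈ hull A, blk π k 0 - blk π k l ∈ Ideal.span (rel π k '' A) := by
    intro l
    refine Fin.cases ?_ (fun i hi => ?_) l
    · simp
    · exact Ideal.subset_span ⟨i, succ_mem_hull.1 hi, rfl⟩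
  have := sub_mem (key m hm) (key l hl)
  rwa [sub_sub_sub_cancel_left] at this

/-- Two monomials with the same image in the Rees algebra are congruent. -/
lemma mon_sub_mon_mem {A : Finset (Fin N)} (a a' : σ →₀ ℕ) (c c' : Fin (N + 1) →₀ ℕ)
    (hc : ∀ l ∉ hull A, c l = c' l) (hsum : ∑ l ∈ hull A, c l = ∑ l ∈ hull A, c' l)
    (ha : ∀ v, π v ∉ hull A → a v = a' v)
    (ha' : ∀ v, π v ∈ hull A → a v + c' (π v) = a' v + c (π v)) :
    mon k a c - mon k a' c' ∈ Ideal.span (rel π k '' A) := by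
  induction hM : ∑ l ∈ hull A, (c l - c' l) using Nat.strong_induction_on generalizing a c with
  | _ M ih =>
  by_cases hle : ∀ l ∈ hull A, c l ≤ c' l
  · have heq := (Finset.sum_eq_sum_iff_of_le hle).1 hsum
    have h1 : c = c' := by
      ext l
      by_cases hl : l ∈ hull A
      · exact heq l hl
      · exact hc l hl
    have h2 : a = a' := by
      ext v
      by_cases hv : π v ∈ hull A
      · have := ha' v hv
        rw [h1] at this
        omega
      · exact ha v hv
    simp [h1, h2]
  · push Not at hle
    obtain ⟨l, hl, hlt⟩ := hle
    obtain ⟨m, hm, hmlt⟩ : ∃ m ∈ hull A, c m < c' m := by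
      by_contra! hcon
      exact (Finset.sum_lt_sum hcon ⟨l, hl, hlt⟩).ne' hsum
    have hlm : l ≠ m := by rintro rfl; omega
    obtain ⟨a₀, rfl⟩ : ∃ a₀, a = (ind fun v => π v = l) + a₀ := by
      refine ⟨a - ind fun v => π v = l, ?_⟩
      ext v
      simp only [Finsupp.add_apply, Finsupp.tsub_apply, ind_apply]
      split_ifs with h
      · have := ha' v (h ▸ hl)
        rw [h] at this
        omega
      · omega
    obtain ⟨c₀, rfl⟩ : ∃ c₀, c = Finsupp.single l 1 + c₀ := by
      refine ⟨c - Finsupp.single l 1, ?_⟩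
      ext j
      simp only [Finsupp.add_apply, Finsupp.tsub_apply, Finsupp.single_apply]
      split_ifs with h
      · subst h; omega
      · omega
    have hstep : mon k ((ind fun v => π v = l) + a₀) (Finsupp.single l 1 + c₀) -
        mon k ((ind fun v => π v = m) + a₀) (Finsupp.single m 1 + c₀) ∈
          Ideal.span (rel π k '' A) := by
      rw [← mon_mul, ← mon_mul, ← sub_mul]
      exact Ideal.mul_mem_right _ _ (blk_sub_blk_mem π hl hm)
    have hrest : mon k ((ind fun v => π v = m) + a₀) (Finsupp.single m 1 + c₀) - mon k a' c' ∈
        Ideal.span (rel π k '' A) := by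
      have hs1 : ∀ j ∈ hull A, ∑ i ∈ hull A, (Finsupp.single j 1 : Fin (N + 1) →₀ ℕ) i = 1 := by
        intro j hj
        rw [Finset.sum_eq_single j (fun i _ h => by simp [h.symm]) (fun h => absurd hj h)]
        simp
      refine ih _ ?_ _ _ ?_ ?_ ?_ ?_ rfl
      · rw [← hM]
        refine Finset.sum_lt_sum (fun i _ => ?_) ⟨l, hl, ?_⟩
        · simp only [Finsupp.add_apply, Finsupp.single_apply] at hmlt ⊢
          rcases eq_or_ne m i with rfl | h
          · simp only [if_true, if_neg hlm] at hmlt ⊢; omega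
          · simp only [if_neg h]; omega
        · simp only [Finsupp.add_apply, Finsupp.single_apply, if_neg hlm.symm, if_true] at hlt ⊢
          omega
      · intro i hi
        have := hc i hi
        rw [Finsupp.add_apply, Finsupp.single_eq_of_ne (by rintro rfl; exact hi hl)] at this
        rw [Finsupp.add_apply, Finsupp.single_eq_of_ne (by rintro rfl; exact hi hm), this]
      · rw [← hsum]
        simp only [Finsupp.add_apply, Finset.sum_add_distrib, hs1 l hl, hs1 m hm]
      · intro v hv
        have := ha v hv
        simp only [Finsupp.add_apply, ind_apply] at this ⊢
        rw [if_neg (by rintro rfl; exact hv hl)] at this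
        rw [if_neg (by rintro rfl; exact hv hm), this]
      · intro v hv
        have := ha' v hv
        simp only [Finsupp.add_apply, ind_apply, Finsupp.single_apply, eq_comm (a := π v)]
          at this ⊢
        omega
    have := add_mem hstep hrest
    rwa [sub_add_sub_cancel] at this

/-- The parametrisation of the partial Rees algebra defined by the relations indexed by `A`. -/
noncomputable def par (k : Type*) [Field k] (A : Finset (Fin N)) :
    MvPolynomial (Fin (N + 1)) (MvPolynomial σ k) →ₐ[MvPolynomial σ k]
      MvPolynomial (Fin (N + 1)) (MvPolynomial σ k) :=
  aeval fun l => mon k (if l ∈ hull A then ind fun v => π v ∈ hull A ∧ π v ≠ l else 0)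
    (Finsupp.single (if l ∈ hull A then 0 else l) 1)

lemma par_mon (A : Finset (Fin N)) (a : σ →₀ ℕ) (c : Fin (N + 1) →₀ ℕ) :
    par π k A (mon k a c) = mon k
      (a + ∑ l, c l • (if l ∈ hull A then ind fun v => π v ∈ hull A ∧ π v ≠ l else 0))
      (∑ l, c l • Finsupp.single (if l ∈ hull A then 0 else l) 1) := by
  have h : (algebraMap (MvPolynomial σ k) (MvPolynomial (Fin (N + 1)) (MvPolynomial σ k)))
      (monomial a 1) = mon k a 0 := rfl
  rw [par, mon, aeval_monomial, h, Finsupp.prod_fintype _ _ (by simp)]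
  simp only [mon_pow, mon_prod, mon_mul, zero_add]

lemma par_blk (A : Finset (Fin N)) (l : Fin (N + 1)) :
    par π k A (blk π k l) = mon k
      ((ind fun v => π v = l) + if l ∈ hull A then ind fun v => π v ∈ hull A ∧ π v ≠ l else 0)
      (Finsupp.single (if l ∈ hull A then 0 else l) 1) := by
  rw [blk, par_mon]
  congr 1
  · congr 1
    rw [Finset.sum_eq_single l (fun i _ h => by simp [h.symm]) (by simp)]
    simp
  · rw [Finset.sum_eq_single l (fun i _ h => by simp [h.symm]) (by simp)]
    simp

lemma par_blk_of_mem {A : Finset (Fin N)} {l : Fin (N + 1)} (hl : l ∈ hull A) :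
    par π k A (blk π k l) = mon k (ind fun v => π v ∈ hull A) (Finsupp.single 0 1) := by
  rw [par_blk, if_pos hl, if_pos hl]
  congr 1
  ext v
  simp only [Finsupp.add_apply, ind_apply]
  by_cases h : π v = l
  · simp [h, hl]
  · simp [h]

lemma ker_par (A : Finset (Fin N)) {b : MvPolynomial (Fin (N + 1)) (MvPolynomial σ k)} :
    par π k A b = 0 ↔ b ∈ Ideal.span (rel π k '' A) := by
  constructor
  · let bs : Module.Basis ((σ →₀ ℕ) × (Fin (N + 1) →₀ ℕ)) k
        (MvPolynomial (Fin (N + 1)) (MvPolynomial σ k)) :=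
      (basisMonomials σ k).smulTower (basisMonomials (Fin (N + 1)) (MvPolynomial σ k))
    have hbs : ∀ p, bs p = mon k p.1 p.2 := by
      intro p
      simp only [bs, Module.Basis.smulTower_apply, coe_basisMonomials, mon]
      rw [smul_monomial, smul_eq_mul, mul_one]
    intro hb
    refine ker_le_of_basis bs bs ((par π k A).toLinearMap.restrictScalars k)
      (fun p => (p.1 + ∑ l, p.2 l •
        (if l ∈ hull A then ind fun v => π v ∈ hull A ∧ π v ≠ l else 0),
        ∑ l, p.2 l • Finsupp.single (if l ∈ hull A then 0 else l) 1))
      (fun p => ?_) ((Ideal.span (rel π k '' A)).restrictScalars k) ?_ hb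
    · rw [hbs, hbs]
      exact par_mon π A p.1 p.2
    · rintro ⟨a, c⟩ ⟨a', c'⟩ h
      rw [hbs, hbs]
      simp only [Prod.mk.injEq] at h
      obtain ⟨h1, h2⟩ := h
      have hsum : ∑ l ∈ hull A, c l = ∑ l ∈ hull A, c' l := by
        have key : ∀ c : Fin (N + 1) →₀ ℕ, (∑ l, c l •
            (Finsupp.single (if l ∈ hull A then 0 else l) 1 : Fin (N + 1) →₀ ℕ)) 0 =
            ∑ l ∈ hull A, c l := by
          intro c
          rw [Finsupp.finsetSum_apply]
          refine (Finset.sum_congr rfl fun l _ => ?_).trans ((Finset.sum_ite_mem Finset.univ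
            (hull A) c).trans (by rw [Finset.univ_inter]))
          split_ifs with hl
          · simp
          · have : l ≠ 0 := by rintro rfl; exact hl (zero_mem_hull A)
            simp [this]
        rw [← key, ← key, h2]
      refine mon_sub_mon_mem π a a' c c' (fun j hj => ?_) hsum (fun v hv => ?_) (fun v hv => ?_)
      · have key : ∀ c : Fin (N + 1) →₀ ℕ, (∑ l, c l •
            (Finsupp.single (if l ∈ hull A then 0 else l) 1 : Fin (N + 1) →₀ ℕ)) j = c j := by
          intro c
          rw [Finsupp.finsetSum_apply, Finset.sum_eq_single j (fun i _ hi => ?_) (by simp)]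
          · simp [hj]
          · have : (if i ∈ hull A then 0 else i) ≠ j := by
              split_ifs
              · rintro rfl; exact hj (zero_mem_hull A)
              · exact hi
            simp [this]
        rw [← key c, ← key c', h2]
      · have := DFunLike.congr_fun h1 v
        have key : ∀ c : Fin (N + 1) →₀ ℕ, (∑ l, c l •
            (if l ∈ hull A then ind fun v => π v ∈ hull A ∧ π v ≠ l else 0)) v = 0 := by
          intro c
          rw [Finsupp.finsetSum_apply]
          refine Finset.sum_eq_zero fun l _ => ?_
          split_ifs <;> simp [ind_apply, hv]
        rwa [Finsupp.add_apply, Finsupp.add_apply, key, key] at this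
      · have := DFunLike.congr_fun h1 v
        have key : ∀ c : Fin (N + 1) →₀ ℕ, (∑ l, c l •
            (if l ∈ hull A then ind fun v => π v ∈ hull A ∧ π v ≠ l else 0)) v + c (π v) =
              ∑ l ∈ hull A, c l := by
          intro c
          rw [← Finset.sum_erase_add _ _ hv, Finsupp.finsetSum_apply,
            ← Finset.univ_inter ((hull A).erase (π v)), ← Finset.sum_ite_mem]
          congr 1
          refine Finset.sum_congr rfl fun l _ => ?_
          by_cases hl : l ∈ hull A <;> by_cases hl' : l = π v <;>
            simp [hl, hl', hv, ind_apply, eq_comm]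
        have k1 := key c
        have k2 := key c'
        rw [Finsupp.add_apply, Finsupp.add_apply] at this
        omega
  · intro hb
    have : Ideal.span (rel π k '' A) ≤ RingHom.ker (par π k A) := by
      rw [Ideal.span_le]
      rintro _ ⟨m, hm, rfl⟩
      change par π k A (rel π k m) = 0
      rw [rel, map_sub, par_blk_of_mem π (zero_mem_hull A),
        par_blk_of_mem π (succ_mem_hull.2 hm), sub_self]
    exact this hb

lemma par_rel_ne_zero {A : Finset (Fin N)} {m : Fin N} (hm : m ∉ A) :
    par π k A (rel π k m) ≠ 0 := by
  rw [rel, map_sub, par_blk_of_mem π (zero_mem_hull A), par_blk, if_neg (by rwa [succ_mem_hull]),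
    if_neg (by rwa [succ_mem_hull]), sub_ne_zero]
  intro h
  have := congrArg (coeff (Finsupp.single 0 1)) h
  rw [mon, mon, coeff_monomial, coeff_monomial, if_pos rfl, if_neg] at this
  · simp at this
  · intro h
    exact Fin.succ_ne_zero m ((Finsupp.single_left_inj one_ne_zero).1 h)

/-- The relations form a permutable regular sequence. -/
lemma rel_regular (A : Finset (Fin N)) (m : Fin N) (hm : m ∉ A)
    (b : MvPolynomial (Fin (N + 1)) (MvPolynomial σ k))
    (h : rel π k m * b ∈ Ideal.span (rel π k '' A)) : b ∈ Ideal.span (rel π k '' A) := by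
  rw [← ker_par, map_mul] at h
  exact (ker_par π A).1 ((mul_eq_zero.1 h).resolve_left (par_rel_ne_zero π hm))

end Multipartite

namespace Multipartite

open GradedFree

variable {k : Type*} [Field k] {σ : Type*} {N : ℕ}

/-- The indices of the basis of the resolution of the `s`-th power of the cover ideal. -/
def Idx (N s : ℕ) : ℕ → Type
  | 0 => Unit
  | i + 1 => {p : Finset (Fin N) × (Fin (N + 1) →₀ ℕ) // p.1.card = i ∧ p.2.degree + i = s}

namespace Idx

variable {s i : ℕ}

/-- The index in degree zero. -/
def root : Idx N s 0 := ()

/-- The index given by a set and an exponent vector. -/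
def mk (T : Finset (Fin N)) (c : Fin (N + 1) →₀ ℕ) (h : T.card = i ∧ c.degree + i = s) :
    Idx N s (i + 1) := ⟨(T, c), h⟩

/-- The set of an index. -/
def set (p : Idx N s (i + 1)) : Finset (Fin N) := p.1.1

/-- The exponent vector of an index. -/
def exp (p : Idx N s (i + 1)) : Fin (N + 1) →₀ ℕ := p.1.2

lemma card_set (p : Idx N s (i + 1)) : p.set.card = i := p.2.1

lemma degree_exp (p : Idx N s (i + 1)) : p.exp.degree + i = s := p.2.2

lemma mk_set_exp (p : Idx N s (i + 1)) : mk p.set p.exp ⟨p.card_set, p.degree_exp⟩ = p := rfl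

lemma exp_mk (T : Finset (Fin N)) (c : Fin (N + 1) →₀ ℕ) (h : T.card = i ∧ c.degree + i = s) :
    (mk T c h).exp = c := rfl

end Idx

instance (N s i : ℕ) : Finite (Idx N s (i + 1)) := by
  refine Finite.of_injective (β := Finset (Fin N) × (Fin (N + 1) → Fin (s + 1)))
    (fun p => (p.set, fun l => ⟨p.exp l, ?_⟩)) ?_
  · have h1 := p.degree_exp
    have h2 := Finsupp.le_degree l p.exp
    omega
  · intro p q h
    simp only [Prod.mk.injEq, funext_iff, Fin.mk.injEq] at h
    exact Subtype.ext (Prod.ext h.1 (Finsupp.ext h.2))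

instance (N s : ℕ) : Unique (Idx N s 0) := inferInstanceAs (Unique Unit)

/-- The element of the Koszul complex with given coordinates. -/
noncomputable def ev (k σ : Type*) [Field k] (N s i : ℕ) :
    (Idx N s (i + 1) →₀ MvPolynomial σ k) →ₗ[MvPolynomial σ k]
      (Finset (Fin N) → MvPolynomial (Fin (N + 1)) (MvPolynomial σ k)) :=
  Finsupp.linearCombination _ fun p => Pi.single p.set (monomial p.exp 1)

/-- The coordinates of an element of the Koszul complex. -/
noncomputable def rd (k σ : Type*) [Field k] (N s i : ℕ) :
    (Finset (Fin N) → MvPolynomial (Fin (N + 1)) (MvPolynomial σ k)) →ₗ[MvPolynomial σ k]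
      (Idx N s (i + 1) →₀ MvPolynomial σ k) :=
  (Finsupp.linearEquivFunOnFinite _ _ _).symm.toLinearMap ∘ₗ
    LinearMap.pi fun p => lcoeff _ p.exp ∘ₗ LinearMap.proj p.set

lemma rd_apply (s i : ℕ) (κ : Finset (Fin N) → MvPolynomial (Fin (N + 1)) (MvPolynomial σ k))
    (p : Idx N s (i + 1)) : rd k σ N s i κ p = coeff p.exp (κ p.set) := rfl

lemma coeff_ev (s i : ℕ) (x : Idx N s (i + 1) →₀ MvPolynomial σ k) (T : Finset (Fin N))
    (c : Fin (N + 1) →₀ ℕ) : coeff c (ev k σ N s i x T) =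
      if h : T.card = i ∧ c.degree + i = s then x (.mk T c h) else 0 := by
  classical
  induction x using Finsupp.induction_linear with
  | zero => simp
  | add x y hx hy =>
    rw [map_add, Pi.add_apply, coeff_add, hx, hy]
    split_ifs
    · rw [Finsupp.add_apply]
    · rw [add_zero]
  | single p a =>
    rw [ev, Finsupp.linearCombination_single, Pi.smul_apply, coeff_smul, Pi.single_apply]
    by_cases hT : T = p.set
    · subst hT
      by_cases hc : c = p.exp
      · subst hc
        rw [if_pos rfl, coeff_monomial, if_pos rfl, smul_eq_mul, mul_one,
          dif_pos ⟨p.card_set, p.degree_exp⟩, Idx.mk_set_exp, Finsupp.single_eq_same]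
      · rw [if_pos rfl, coeff_monomial, if_neg (Ne.symm hc), smul_zero]
        split_ifs
        · rw [Finsupp.single_eq_of_ne]
          exact fun h => hc (congrArg Idx.exp h)
        · rfl
    · rw [if_neg hT, coeff_zero, smul_zero]
      split_ifs
      · rw [Finsupp.single_eq_of_ne]
        exact fun h => hT (congrArg Idx.set h)
      · rfl

lemma rd_ev (s i : ℕ) (x : Idx N s (i + 1) →₀ MvPolynomial σ k) :
    rd k σ N s i (ev k σ N s i x) = x := by
  ext1 p
  rw [rd_apply, coeff_ev, dif_pos ⟨p.card_set, p.degree_exp⟩, Idx.mk_set_exp]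

lemma coeff_ev_rd (s i : ℕ)
    (κ : Finset (Fin N) → MvPolynomial (Fin (N + 1)) (MvPolynomial σ k)) (T : Finset (Fin N))
    (c : Fin (N + 1) →₀ ℕ) : coeff c (ev k σ N s i (rd k σ N s i κ) T) =
      if T.card = i ∧ c.degree + i = s then coeff c (κ T) else 0 := by
  rw [coeff_ev]
  split_ifs <;> rfl

/-- The possible coefficients, at a basis vector of degree `d`, of homogeneous elements of
degree `e`. -/
noncomputable def homogCoeff (k σ : Type*) [Field k] (e d : ℕ) : Submodule k (MvPolynomial σ k) :=
  if d ≤ e then homogeneousSubmodule σ k (e - d) else ⊥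

lemma isHomog_iff {ι : Type*} {deg : ι → ℕ} {e : ℕ} {f : ι →₀ MvPolynomial σ k} :
    IsHomog deg e f ↔ ∀ p, f p ∈ homogCoeff k σ e (deg p) := by
  refine forall_congr' fun p => ?_
  rw [homogCoeff]
  split_ifs with h
  · exact ⟨fun h => h.1, fun h' => ⟨h', fun h'' => by omega⟩⟩
  · exact ⟨fun h' => (Submodule.mem_bot _).2 (h'.2 (by omega)), fun h' => by
      rw [(Submodule.mem_bot _).1 h']; exact ⟨isHomogeneous_zero _ _ _, fun _ => rfl⟩⟩

lemma isHomogeneous_ev (s : ℕ) (x : Idx N s 1 →₀ MvPolynomial σ k) :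
    (ev k σ N s 0 x ∅).IsHomogeneous s := by
  intro c hc
  rw [coeff_ev] at hc
  split_ifs at hc with h
  · rw [← h.2, add_zero, Finsupp.degree_eq_weight_one]; rfl
  · exact absurd rfl hc

variable [Fintype σ] (π : σ → Fin (N + 1))

lemma coeff_blk_mul (l : Fin (N + 1)) (b : MvPolynomial (Fin (N + 1)) (MvPolynomial σ k))
    (c : Fin (N + 1) →₀ ℕ) : coeff c (blk π k l * b) = if Finsupp.single l 1 ≤ c then
      monomial (ind fun v => π v = l) 1 * coeff (c - Finsupp.single l 1) b else 0 := by
  rw [blk, mon, coeff_monomial_mul']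

/-- The Koszul differential of the defining relations of the Rees algebra. -/
noncomputable def kdiff (k : Type*) [Field k] :
    (Finset (Fin N) → MvPolynomial (Fin (N + 1)) (MvPolynomial σ k)) →ₗ[MvPolynomial σ k]
      (Finset (Fin N) → MvPolynomial (Fin (N + 1)) (MvPolynomial σ k)) :=
  (Koszul.diff (rel π k) Finset.univ).restrictScalars _

lemma kdiff_apply (κ : Finset (Fin N) → MvPolynomial (Fin (N + 1)) (MvPolynomial σ k))
    (T : Finset (Fin N)) : kdiff π k κ T = ∑ m, rel π k m *
      if m ∈ T then 0 else Koszul.sgn _ m T * κ (insert m T) := by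
  change Koszul.diff _ _ κ T = _
  simp only [Koszul.diff_apply, Finset.sum_apply, Pi.smul_apply, Koszul.contr_apply, smul_eq_mul]

lemma kdiff_ev_rd (s i : ℕ)
    (κ : Finset (Fin N) → MvPolynomial (Fin (N + 1)) (MvPolynomial σ k)) :
    kdiff π k (ev k σ N s (i + 1) (rd k σ N s (i + 1) κ)) =
      ev k σ N s i (rd k σ N s i (kdiff π k κ)) := by
  ext1 T
  ext1 c
  rw [coeff_ev_rd, kdiff_apply, kdiff_apply, coeff_sum, coeff_sum]
  have key : ∀ l : Fin (N + 1), ∀ m ∉ T,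
      coeff c (blk π k l * ev k σ N s (i + 1) (rd k σ N s (i + 1) κ) (insert m T)) =
        if T.card = i ∧ c.degree + i = s then coeff c (blk π k l * κ (insert m T)) else 0 := by
    intro l m hm
    rw [coeff_blk_mul, coeff_blk_mul, coeff_ev_rd, Finset.card_insert_of_notMem hm]
    by_cases hc : Finsupp.single l 1 ≤ c
    · have : (c - Finsupp.single l 1).degree + 1 = c.degree := by
        conv_rhs => rw [← tsub_add_cancel_of_le hc]
        simp
      have hiff : (T.card + 1 = i + 1 ∧ (c - Finsupp.single l 1).degree + (i + 1) = s) ↔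
          (T.card = i ∧ c.degree + i = s) := by omega
      simp only [if_pos hc, hiff]
      split_ifs <;> simp
    · simp only [if_neg hc, ite_self]
  have key2 : ∀ m ∉ T, coeff c (rel π k m * (Koszul.sgn _ m T *
      ev k σ N s (i + 1) (rd k σ N s (i + 1) κ) (insert m T))) =
        if T.card = i ∧ c.degree + i = s then
          coeff c (rel π k m * (Koszul.sgn _ m T * κ (insert m T))) else 0 := by
    intro m hm
    rcases neg_one_pow_eq_or (MvPolynomial (Fin (N + 1)) (MvPolynomial σ k))
      (T.filter (· < m)).card with h | h <;>
    · simp only [Koszul.sgn, h, rel, sub_mul, one_mul, neg_mul, mul_neg, coeff_sub, coeff_neg,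
        key 0 m hm, key m.succ m hm]
      split_ifs <;> simp
  split_ifs with h
  · refine Finset.sum_congr rfl fun m _ => ?_
    by_cases hm : m ∈ T
    · simp [hm]
    · rw [if_neg hm, if_neg hm, key2 m hm, if_pos h]
  · refine Finset.sum_eq_zero fun m _ => ?_
    by_cases hm : m ∈ T
    · simp [hm]
    · rw [if_neg hm, key2 m hm, if_neg h]

lemma kdiff_kdiff (κ : Finset (Fin N) → MvPolynomial (Fin (N + 1)) (MvPolynomial σ k)) :
    kdiff π k (kdiff π k κ) = 0 := Koszul.diff_diff _ _ κ

/-- The generators of the cover ideal. -/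
noncomputable def gen (k : Type*) [Field k] (l : Fin (N + 1)) : MvPolynomial σ k :=
  monomial (ind fun v => π v ≠ l) 1

lemma degree_eq_of_isHomogeneous {R τ : Type*} [CommSemiring R] {s : ℕ} {b : MvPolynomial τ R}
    (hb : b.IsHomogeneous s) {c : τ →₀ ℕ} (hc : coeff c b ≠ 0) : c.degree = s := by
  rw [← hb hc, Finsupp.degree_eq_weight_one]; rfl

lemma par_univ_of_isHomogeneous {s : ℕ} {b : MvPolynomial (Fin (N + 1)) (MvPolynomial σ k)}
    (hb : b.IsHomogeneous s) : par π k Finset.univ b = C (eval (gen π k) b) * X 0 ^ s := by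
  have hX : ∀ l, mon k (if l ∈ hull Finset.univ then ind fun v => π v ∈ hull Finset.univ ∧ π v ≠ l
      else 0) (Finsupp.single (if l ∈ hull Finset.univ then 0 else l) 1) =
      C (gen π k l) * (X 0 : MvPolynomial (Fin (N + 1)) (MvPolynomial σ k)) := by
    intro l
    simp only [hull_univ, Finset.mem_univ, if_true, true_and, gen, mon]
    rw [C_mul_X_eq_monomial]
  rw [b.as_sum, map_sum, map_sum, map_sum, Finset.sum_mul]
  refine Finset.sum_congr rfl fun c hc => ?_
  have hdeg : c.degree = s := degree_eq_of_isHomogeneous hb (mem_support_iff.1 hc)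
  rw [par, aeval_monomial, eval_monomial]
  simp only [hX, mul_pow]
  rw [← hdeg, Finsupp.degree_eq_sum, Finsupp.prod_fintype _ _ (by simp),
    Finsupp.prod_fintype _ _ (by simp), Finset.prod_mul_distrib, Finset.prod_pow_eq_pow_sum,
    map_mul, map_prod, mul_assoc]
  simp only [map_pow]
  rfl

lemma eval_rel (m : Fin N) : eval (gen π k) (rel π k m) = 0 := by
  have : ∀ l, eval (gen π k) (blk π k l) = monomial (ind fun _ => True) 1 := by
    intro l
    rw [blk, mon, eval_monomial, Finsupp.prod_single_index (by simp), pow_one, gen, monomial_mul,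
      one_mul]
    congr 2
    ext v
    simp only [Finsupp.add_apply, ind_apply, if_true]
    by_cases h : π v = l <;> simp [h]
  rw [rel, map_sub, this, this, sub_self]

/-- The differentials of the resolution of a power of the cover ideal. -/
noncomputable def resDiff (k : Type*) [Field k] (s : ℕ) : ∀ i,
    (Idx N s (i + 1) →₀ MvPolynomial σ k) →ₗ[MvPolynomial σ k]
    (Idx N s i →₀ MvPolynomial σ k)
  | 0 => Finsupp.lsingle Idx.root ∘ₗ (aeval (gen π k)).toLinearMap ∘ₗ LinearMap.proj ∅ ∘ₗ ev k σ N s 0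
  | i + 1 => rd k σ N s i ∘ₗ kdiff π k ∘ₗ ev k σ N s (i + 1)

lemma resDiff_zero (s : ℕ) (x : Idx N s 1 →₀ MvPolynomial σ k) :
    resDiff π k s 0 x = Finsupp.single Idx.root (eval (gen π k) (ev k σ N s 0 x ∅)) := rfl

lemma resDiff_succ (s i : ℕ) (x : Idx N s (i + 2) →₀ MvPolynomial σ k) :
    resDiff π k s (i + 1) x = rd k σ N s i (kdiff π k (ev k σ N s (i + 1) x)) := rfl

lemma ev_resDiff (s i : ℕ) (x : Idx N s (i + 2) →₀ MvPolynomial σ k) :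
    ev k σ N s i (resDiff π k s (i + 1) x) = kdiff π k (ev k σ N s (i + 1) x) := by
  rw [resDiff_succ, ← kdiff_ev_rd, rd_ev]

lemma resDiff_rd (s i : ℕ)
    (κ : Finset (Fin N) → MvPolynomial (Fin (N + 1)) (MvPolynomial σ k)) :
    resDiff π k s (i + 1) (rd k σ N s (i + 1) κ) = rd k σ N s i (kdiff π k κ) := by
  rw [resDiff_succ, kdiff_ev_rd, rd_ev]

lemma ker_resDiff_zero (s : ℕ) :
    LinearMap.ker (resDiff π k s 0) = LinearMap.range (resDiff π k s 1) := by
  ext x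
  rw [LinearMap.mem_ker, LinearMap.mem_range]
  constructor
  · intro hx
    rw [resDiff_zero, Finsupp.single_eq_zero] at hx
    have hmem : ev k σ N s 0 x ∅ ∈ Ideal.span (rel π k '' (Finset.univ : Finset (Fin N))) := by
      rw [← ker_par, par_univ_of_isHomogeneous π (isHomogeneous_ev s x), hx, C_0, zero_mul]
    obtain ⟨μ, -, -, hμ⟩ := Koszul.exists_diff_empty_eq _ _ hmem
    refine ⟨rd k σ N s 1 μ, ?_⟩
    rw [resDiff_rd, ← rd_ev s 0 x]
    ext1 p
    have hp : p.set = ∅ := Finset.card_eq_zero.1 p.card_set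
    rw [rd_apply, rd_apply, hp]
    exact congrArg _ hμ
  · rintro ⟨z, rfl⟩
    rw [resDiff_zero, ev_resDiff, kdiff_apply, map_sum]
    rw [Finset.sum_eq_zero fun m _ => by rw [map_mul, eval_rel, zero_mul], Finsupp.single_zero]

lemma ker_resDiff_succ (s i : ℕ) :
    LinearMap.ker (resDiff π k s (i + 1)) = LinearMap.range (resDiff π k s (i + 2)) := by
  ext x
  rw [LinearMap.mem_ker, LinearMap.mem_range]
  constructor
  · intro hx
    have hd : kdiff π k (ev k σ N s (i + 1) x) = 0 := by rw [← ev_resDiff, hx, map_zero]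
    have h0 : ev k σ N s (i + 1) x ∅ = 0 := by
      ext1 c
      rw [coeff_ev, dif_neg (by simp)]; rfl
    obtain ⟨μ, -, -, hμ⟩ := Koszul.exists_diff_eq (rel_regular π) Finset.univ _ h0
      (fun l hl => absurd (Finset.mem_univ l) hl) hd
    refine ⟨rd k σ N s (i + 2) μ, ?_⟩
    rw [resDiff_rd, ← rd_ev s (i + 1) x]
    exact congrArg _ hμ
  · rintro ⟨z, rfl⟩
    rw [resDiff_succ, ev_resDiff, kdiff_kdiff, map_zero]

lemma range_resDiff_zero (s : ℕ) (x : Idx N s 0 →₀ MvPolynomial σ k) :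
    x ∈ LinearMap.range (resDiff π k s 0) ↔ x Idx.root ∈ Ideal.span (Set.range (gen π k)) ^ s := by
  rw [Ideal.mem_span_pow_iff_exists_isHomogeneous, LinearMap.mem_range]
  constructor
  · rintro ⟨z, rfl⟩
    exact ⟨_, isHomogeneous_ev s z, by rw [resDiff_zero]; exact (Finsupp.single_eq_same).symm⟩
  · rintro ⟨p, hp, hx⟩
    refine ⟨rd k σ N s 0 (Pi.single ∅ p), ?_⟩
    have h : ev k σ N s 0 (rd k σ N s 0 (Pi.single ∅ p)) ∅ = p := by
      ext1 c
      rw [coeff_ev_rd, Pi.single_eq_same]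
      split_ifs with h
      · rfl
      · by_contra hc
        exact h ⟨rfl, degree_eq_of_isHomogeneous hp (Ne.symm hc)⟩
    rw [resDiff_zero, h, hx]
    exact Finsupp.unique_ext Finsupp.single_eq_same


/-- The number of vertices in the `l`-th part. -/
def size (l : Fin (N + 1)) : ℕ := (Finset.univ.filter fun v => π v = l).card

/-- The number of vertices outside the `l`-th part. -/
def cosize (l : Fin (N + 1)) : ℕ := (Finset.univ.filter fun v => π v ≠ l).card

lemma size_add_cosize (l : Fin (N + 1)) : size π l + cosize π l = Fintype.card σ :=
  Finset.card_filter_add_card_filter_not _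

lemma sum_size : ∑ l, size π l = Fintype.card σ :=
  (Finset.card_eq_sum_card_fiberwise fun _ _ => Finset.mem_coe.2 (Finset.mem_univ _)).symm

/-- The degrees of the basis elements of the resolution. -/
def ideg (s : ℕ) : ∀ i, Idx N s i → ℕ
  | 0, _ => 0
  | i + 1, p => i * Fintype.card σ + ∑ l, p.exp l * cosize π l

lemma ideg_succ (s i : ℕ) (p : Idx N s (i + 1)) :
    ideg π s (i + 1) p = i * Fintype.card σ + ∑ l, p.exp l * cosize π l := rfl

lemma ideg_add (s i : ℕ) (p : Idx N s (i + 1)) :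
    ideg π s (i + 1) p + ∑ l, p.exp l * size π l = s * Fintype.card σ := by
  have h : ∑ l, p.exp l * cosize π l + ∑ l, p.exp l * size π l =
      p.exp.degree * Fintype.card σ := by
    rw [← Finset.sum_add_distrib, Finsupp.degree_eq_sum, Finset.sum_mul]
    exact Finset.sum_congr rfl fun l _ => by rw [← size_add_cosize π l]; ring
  rw [ideg_succ, add_assoc, h, ← add_mul, add_comm i, p.degree_exp]

lemma isHomogeneous_gen (l : Fin (N + 1)) : (gen π k l).IsHomogeneous (cosize π l) :=
  isHomogeneous_monomial _ (degree_ind _)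

lemma coeff_blk_mul_mem (s i : ℕ) (p : Idx N s (i + 2)) (q : Idx N s (i + 1)) (l : Fin (N + 1)) :
    coeff q.exp (blk π k l * monomial p.exp 1) ∈
      homogCoeff k σ (ideg π s (i + 2) p) (ideg π s (i + 1) q) := by
  rw [blk, mon, monomial_mul, mul_one, coeff_monomial]
  split_ifs with h
  · have h1 : ideg π s (i + 1) q + size π l = ideg π s (i + 2) p := by
      have h2 : ∑ j, (Finsupp.single l 1 : Fin (N + 1) →₀ ℕ) j * cosize π j = cosize π l := by
        rw [Finset.sum_eq_single l (fun j _ hj => by simp [hj.symm]) (by simp)]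
        simp
      rw [ideg_succ, ideg_succ, ← h]
      simp only [Finsupp.add_apply, add_mul, Finset.sum_add_distrib, h2, one_mul,
        ← size_add_cosize π l]
      ring
    rw [homogCoeff, if_pos (by omega)]
    exact isHomogeneous_monomial _ ((degree_ind _).trans (by rw [← h1]; simp [size]))
  · exact zero_mem _

lemma isHomog_resDiff (s i : ℕ) (p : Idx N s (i + 1)) :
    IsHomog (ideg π s i) (ideg π s (i + 1) p) (resDiff π k s i (Finsupp.single p 1)) := by
  classical
  have hev : ∀ (i : ℕ) (p : Idx N s (i + 1)),
      ev k σ N s i (Finsupp.single p 1) = Pi.single p.set (monomial p.exp 1) := by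
    intro i p
    rw [ev, Finsupp.linearCombination_single, one_smul]
  cases i with
  | zero =>
    rw [resDiff_zero, hev]
    have hp : p.set = ∅ := Finset.card_eq_zero.1 p.card_set
    rw [hp, Pi.single_eq_same, eval_monomial, one_mul, Finsupp.prod_fintype _ _ (by simp)]
    have h := IsHomogeneous.prod Finset.univ (fun l => gen π k l ^ p.exp l)
      (fun l => cosize π l * p.exp l) fun l _ => (isHomogeneous_gen π l).pow _
    have h2 := isHomog_single (ideg π s 0) Idx.root h
    convert h2 using 1
    simp [ideg, mul_comm]
  | succ i =>
    rw [isHomog_iff]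
    intro q
    rw [resDiff_succ, hev, rd_apply, kdiff_apply, coeff_sum]
    refine sum_mem fun m _ => ?_
    by_cases hm : m ∈ q.set
    · simp [hm]
    rw [if_neg hm, Pi.single_apply]
    split_ifs
    · have hmem := sub_mem (coeff_blk_mul_mem (k := k) π s i p q 0)
        (coeff_blk_mul_mem (k := k) π s i p q m.succ)
      rw [← coeff_sub, ← sub_mul, ← rel] at hmem
      rcases neg_one_pow_eq_or (MvPolynomial (Fin (N + 1)) (MvPolynomial σ k))
        (q.set.filter (· < m)).card with h | h
      · simpa only [Koszul.sgn, h, one_mul] using hmem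
      · simpa only [Koszul.sgn, h, neg_mul, one_mul, mul_neg, coeff_neg] using neg_mem hmem
    · simp

/-- A graded free resolution of the quotient by the `s`-th power of the cover ideal. -/
noncomputable def resolution (k : Type*) [Field k] (s : ℕ) :
    Res (Ideal.span (Set.range (gen π k)) ^ s) (Idx N s) (ideg π s) where
  d := resDiff π k s
  ε := Submodule.mkQ _ ∘ₗ Finsupp.lapply Idx.root
  surj x := by
    obtain ⟨a, rfl⟩ := Submodule.mkQ_surjective _ x
    exact ⟨Finsupp.single Idx.root a, by simp⟩
  exact_zero := by
    ext x
    rw [range_resDiff_zero, LinearMap.mem_ker, LinearMap.comp_apply, Submodule.mkQ_apply,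
      Submodule.Quotient.mk_eq_zero, Finsupp.lapply_apply]
  exact_succ i := by
    cases i with
    | zero => exact ker_resDiff_zero π s
    | succ i => exact ker_resDiff_succ π s i
  d_homog := isHomog_resDiff π s
  ε_homog p := by
    refine ⟨1, isHomogeneous_one _ _, ?_⟩
    rw [Subsingleton.elim p Idx.root]
    simp

attribute [local instance] MvPolynomial.gradedAlgebra in
lemma isHomogeneous_pow (s : ℕ) :
    (Ideal.span (Set.range (gen π k)) ^ s).IsHomogeneous (homogeneousSubmodule σ k) := by
  induction s with
  | zero => rw [pow_zero, Ideal.one_eq_top]; exact Ideal.IsHomogeneous.top _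
  | succ s ih =>
    rw [pow_succ]
    refine ih.mul (Ideal.homogeneous_span _ _ ?_)
    rintro _ ⟨l, rfl⟩
    exact ⟨_, isHomogeneous_gen π l⟩

lemma le_sum_exp {s i : ℕ} (hmono : ∀ l, size π 0 ≤ size π l) (p : Idx N s (i + 1)) :
    size π 0 * (s - i) ≤ ∑ l, p.exp l * size π l := by
  have h : s - i = p.exp.degree := by have := p.degree_exp; omega
  rw [h, Finsupp.degree_eq_sum, Finset.mul_sum]
  exact Finset.sum_le_sum fun l _ => by rw [mul_comm]; exact Nat.mul_le_mul_left _ (hmono l)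

/-- The regularity of the quotient by the `s`-th power of the cover ideal. -/
def regVal (s : ℕ) : ℕ :=
  if s < N then s * Fintype.card σ - (s + 1)
  else s * Fintype.card σ - size π 0 * (s - N) - (N + 1)

variable {π} in
lemma regVal_spec {s : ℕ} (hN : 1 ≤ N) (hs : 1 ≤ s) (h0 : 1 ≤ size π 0)
    (hmono : ∀ l, size π 0 ≤ size π l) :
    if s < N then s * Fintype.card σ = regVal π s + (s + 1)
    else s * Fintype.card σ = regVal π s + size π 0 * (s - N) + (N + 1) := by
  have hW : (N + 1) * size π 0 ≤ Fintype.card σ := by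
    rw [← sum_size π]
    simpa using Finset.sum_le_sum fun l (_ : l ∈ Finset.univ) => hmono l
  have hW' : s * ((N + 1) * size π 0) ≤ s * Fintype.card σ := Nat.mul_le_mul_left _ hW
  rw [regVal]
  split_ifs with h
  · have : s + 1 ≤ s * ((N + 1) * size π 0) := by nlinarith [Nat.mul_le_mul hN h0]
    omega
  · obtain ⟨r, rfl⟩ := Nat.exists_eq_add_of_le (not_lt.1 h)
    have : size π 0 * r + (N + 1) ≤ (N + r) * ((N + 1) * size π 0) := by
      nlinarith [Nat.mul_le_mul hN h0, Nat.zero_le (r * N * size π 0),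
        Nat.mul_le_mul hN (Nat.mul_le_mul hN h0), Nat.mul_le_mul_left N h0,
        Nat.mul_le_mul_left (N * N) h0]
    rw [Nat.add_sub_cancel_left]
    omega

variable {π} in
lemma ideg_le {s : ℕ} (hN : 1 ≤ N) (hs : 1 ≤ s) (h0 : 1 ≤ size π 0)
    (hmono : ∀ l, size π 0 ≤ size π l)
    (i : ℕ) (p : Idx N s i) : ideg π s i p ≤ i + regVal π s := by
  cases i with
  | zero => exact Nat.zero_le _
  | succ i =>
    have hR := regVal_spec hN hs h0 hmono
    have h1 := ideg_add π s i p
    have h2 := le_sum_exp π hmono p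
    have h3 := p.degree_exp
    have h4 : i ≤ N := by
      have := Finset.card_le_univ p.set
      rwa [p.card_set, Fintype.card_fin] at this
    split_ifs at hR with h
    · have := Nat.mul_le_mul_right (s - i) h0
      omega
    · have h5 : size π 0 * (s - i) = size π 0 * (s - N) + size π 0 * (N - i) := by
        rw [← mul_add]; congr 1; omega
      have := Nat.mul_le_mul_right (N - i) h0
      omega

variable {π} in
lemma exists_ideg_eq {s : ℕ} (hN : 1 ≤ N) (hs : 1 ≤ s) (h0 : 1 ≤ size π 0)
    (hmono : ∀ l, size π 0 ≤ size π l) :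
    ∃ t, IsEmpty (Idx N s (t + 2)) ∧ ∃ p : Idx N s (t + 1),
      ideg π s (t + 1) p = t + 1 + regVal π s ∧
      ∀ q : Idx N s t, ideg π s t q ≠ ideg π s (t + 1) p := by
  obtain ⟨t, ht⟩ : ∃ t, t = min N s := ⟨_, rfl⟩
  obtain ⟨T, -, hT⟩ := Finset.exists_subset_card_eq (s := (Finset.univ : Finset (Fin N))) (n := t)
    (by simp [ht])
  have hR := regVal_spec hN hs h0 hmono
  let p : Idx N s (t + 1) := .mk T (Finsupp.single 0 (s - t))
    ⟨hT, by rw [Finsupp.degree_single]; omega⟩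
  have hp : ideg π s (t + 1) p + size π 0 * (s - t) = s * Fintype.card σ := by
    rw [← ideg_add π s t p]
    congr 1
    rw [Finset.sum_eq_single 0 (fun j _ hj => by simp [p, Idx.exp_mk, hj.symm]) (by simp)]
    simp [p, Idx.exp_mk, mul_comm]
  refine ⟨t, ⟨fun q => ?_⟩, p, ?_, ?_⟩
  · have h1 := q.degree_exp
    have h2 := Finset.card_le_univ q.set
    rw [q.card_set, Fintype.card_fin] at h2
    omega
  · split_ifs at hR with h
    · rw [show s - t = 0 by omega, mul_zero] at hp
      omega
    · rw [show s - t = s - N by omega] at hp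
      omega
  · obtain ⟨r, rfl⟩ := Nat.exists_eq_add_of_le' (show 1 ≤ t by omega)
    intro q
    have h1 := ideg_add π s r q
    have h2 := le_sum_exp π hmono q
    rw [show s - r = s - (r + 1) + 1 by omega, mul_add] at h2
    omega

end Multipartite

open scoped Classical in
/-- Let `G` be the complete multipartite graph with parts `V_1 ⊔ ⋯ ⊔ V_n`,
`|V_i| = w_i`, `w_1 ≤ ⋯ ≤ w_n`, and `J(G)` its cover ideal (generated by the
products of the variables outside a single part) in the standard-graded
polynomial ring on the vertex set.  Then
`reg(S/J(G)^s) = s·∑ w_l - (s+1)` if `s < n-1`, and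
`reg(S/J(G)^s) = s·∑ w_l - w_1(s-n+1) - n` if `s ≥ n-1`. -/
theorem regularity_power_cover_ideal_complete_multipartite
    {k : Type*} [Field k] (n s : ℕ) (hn : 2 ≤ n) (hs : 1 ≤ s)
    (w : Fin n → ℕ) (hw1 : ∀ i, 1 ≤ w i) (hmono : Monotone w)
    (J : Ideal (MvPolynomial ((i : Fin n) × Fin (w i)) k))
    (hJ : J = Ideal.span (Set.range fun i : Fin n =>
        ∏ v ∈ Finset.univ.filter (fun v : (i : Fin n) × Fin (w i) => v.1 ≠ i), X v))
    (β : ℕ → ℕ → ℕ)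
    (hβ : IsMinimalGradedFreeResolution k ((i : Fin n) × Fin (w i)) β
      (MvPolynomial ((i : Fin n) × Fin (w i)) k ⧸ (J ^ s))
      (fun dg => {x | ∃ f ∈ homogeneousSubmodule ((i : Fin n) × Fin (w i)) k dg,
        Ideal.Quotient.mk (J ^ s) f = x}))
    (R : ℕ)
    (hR : R = if s < n - 1 then s * (∑ l, w l) - (s + 1)
      else s * (∑ l, w l) - w ⟨0, by omega⟩ * (s + 1 - n) - n) :
    (∀ i j, β i j ≠ 0 → j ≤ i + R) ∧ ∃ i j, β i j ≠ 0 ∧ j = i + R := by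
  subst hJ
  obtain ⟨N, rfl⟩ : ∃ N, n = N + 1 := ⟨n - 1, by omega⟩
  let π : (i : Fin (N + 1)) × Fin (w i) → Fin (N + 1) := Sigma.fst
  have hsize : ∀ l, Multipartite.size π l = w l := by
    intro l
    rw [Multipartite.size, Finset.card_filter, Fintype.sum_sigma,
      Finset.sum_eq_single l (fun i _ hi => by simp [π, hi]) (by simp)]
    simp [π]
  have hcard : Fintype.card ((i : Fin (N + 1)) × Fin (w i)) = ∑ l, w l := by simp
  have hreg : Multipartite.regVal π s = R := by
    rw [hR, Multipartite.regVal, hsize, hcard, Nat.add_sub_cancel, Nat.add_sub_add_right]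
    rfl
  have hgen : (fun i : Fin (N + 1) => ∏ v ∈ Finset.univ.filter
      (fun v : (i : Fin (N + 1)) × Fin (w i) => v.1 ≠ i), (X v : MvPolynomial _ k)) =
        Multipartite.gen π k := by
    funext i
    rw [Multipartite.gen, ← Multipartite.prod_X_eq]
  rw [hgen] at hβ
  obtain ⟨d, ε, hsurj, hex0, hex, hmin, hd, hε⟩ := hβ
  have hsingle : ∀ (βi : ℕ → ℕ) (p : (j : ℕ) × Fin (βi j)),
      HomogOfDeg k ((i : Fin (N + 1)) × Fin (w i)) βi p.1 (Finsupp.single p 1) :=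
    fun _ p => GradedFree.isHomog_single Sigma.fst p (isHomogeneous_one _ k)
  let F : GradedFree.Res (Ideal.span (Set.range (Multipartite.gen π k)) ^ s)
      (fun i => (j : ℕ) × Fin (β i j)) (fun _ => Sigma.fst) :=
    { d := d
      ε := ε
      surj := hsurj
      exact_zero := hex0
      exact_succ := hex
      d_homog := fun i p => hd i p.1 _ fun q => hsingle _ p q
      ε_homog := fun p => hε p.1 _ fun q => hsingle _ p q }
  let G := Multipartite.resolution π k s
  have hI := Multipartite.isHomogeneous_pow (k := k) π s
  have hN : 1 ≤ N := by omega
  have h0 : 1 ≤ Multipartite.size π 0 := by rw [hsize]; exact hw1 0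
  have hm : ∀ l, Multipartite.size π 0 ≤ Multipartite.size π l := fun l => by
    rw [hsize, hsize]; exact hmono (Fin.zero_le l)
  rw [← hreg]
  constructor
  · intro i j hij
    obtain ⟨q, hq⟩ := F.exists_deg_eq hI G i ⟨j, ⟨0, Nat.pos_of_ne_zero hij⟩⟩
      (fun q => hmin i q _) (fun i' h q => by subst h; exact hmin i' _ q)
    have := Multipartite.ideg_le hN hs h0 hm i q
    rwa [hq] at this
  · obtain ⟨t, hempty, p, hp, hne⟩ := Multipartite.exists_ideg_eq hN hs h0 hm
    obtain ⟨⟨j, a⟩, hj⟩ := G.exists_deg_eq hI F (t + 1) p (fun q => hempty.elim q)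
      (fun i' h q => by
        obtain rfl : i' = t := by omega
        by_contra hc
        exact hne q (GradedFree.constantCoeff_of_isHomog (G.d_homog i' p) hc))
    exact ⟨t + 1, j, (Fin.pos a).ne', hj.trans hp⟩
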